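/- Let κ be a regular uncountable cardinal and let F be a proper filter on κ such that every A ∈ F is unbounded in κ. Then the club-shooting poset C_F is cone homogeneous: for any two conditions x₁, x₂ ∈ C_F there are extensions y₁ ≥ x₁ and y₂ ≥ x₂ and an order isomorphism from the cone {z ∈ C_F : z ≥ y₁} onto the cone {z ∈ C_F : z ≥ y₂}. -/

import Mathlib

/-- A condition of the club-shooting poset `C_F` for a family `F` of subsets of `κ`:
a pair `(c, A)` where `c` is a nonempty bounded closed subset of `κ` and `A ∈ F`. -/
def IsCond (κ : Ordinal) (F : Set (Set Ordinal)) (p : Set Ordinal × Set Ordinal) : Prop :=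
  p.1.Nonempty ∧ p.1 ⊆ Set.Iio κ ∧ sSup p.1 < κ ∧
    (∀ s ⊆ p.1, s.Nonempty → sSup s ∈ p.1) ∧ p.2 ∈ F

/-- `CondExt p q` : the condition `q` extends the condition `p`, i.e.
`q.1 ∩ (max p.1 + 1) = p.1`, `q.2 ⊆ p.2` and `q.1 \ p.1 ⊆ p.2`. -/
def CondExt (p q : Set Ordinal × Set Ordinal) : Prop :=
  q.1 ∩ Set.Iic (sSup p.1) = p.1 ∧ q.2 ⊆ p.2 ∧ q.1 \ p.1 ⊆ p.2

/-- Cone homogeneity of the club-shooting poset `C_F`. -/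
def ConeHomogeneous (κ : Ordinal) (F : Set (Set Ordinal)) : Prop :=
  ∀ p q : Set Ordinal × Set Ordinal, IsCond κ F p → IsCond κ F q →
    ∃ p' q', IsCond κ F p' ∧ IsCond κ F q' ∧ CondExt p p' ∧ CondExt q q' ∧
      ∃ e : {z : Set Ordinal × Set Ordinal // IsCond κ F z ∧ CondExt p' z} ≃
            {z : Set Ordinal × Set Ordinal // IsCond κ F z ∧ CondExt q' z},
        ∀ a b, CondExt a.1 b.1 ↔ CondExt (e a).1 (e b).1

open Set

universe u

lemma IsCond.isGreatest {κ : Ordinal.{u}} {F : Set (Set Ordinal.{u})}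
    {p : Set Ordinal × Set Ordinal} (hp : IsCond κ F p) : IsGreatest p.1 (sSup p.1) :=
  ⟨hp.2.2.2.1 _ subset_rfl hp.1, fun _ hx => le_csSup ⟨κ, fun _ hy => (hp.2.1 hy).le⟩ hx⟩

/-- Replace the part of `z.1` up to `δ` by `D`. -/
def replaceStem (D : Set Ordinal.{u}) (δ : Ordinal.{u}) (z : Set Ordinal.{u} × Set Ordinal.{u}) :
    Set Ordinal.{u} × Set Ordinal.{u} :=
  (D ∪ z.1 ∩ Ioi δ, z.2)

lemma isGreatest_replaceStem {D : Set Ordinal.{u}} {δ m : Ordinal.{u}}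
    {z : Set Ordinal.{u} × Set Ordinal.{u}} (hD : IsGreatest D δ) (hz : IsGreatest z.1 m)
    (hm : δ ≤ m) : IsGreatest (replaceStem D δ z).1 m := by
  refine ⟨?_, ?_⟩
  · rcases hm.eq_or_lt with rfl | h
    · exact Or.inl hD.1
    · exact Or.inr ⟨hz.1, h⟩
  · rintro x (hx | hx)
    · exact (hD.2 hx).trans hm
    · exact hz.2 hx.1

lemma isCond_replaceStem {κ δ : Ordinal.{u}} {F : Set (Set Ordinal.{u})}
    {z p : Set Ordinal.{u} × Set Ordinal.{u}} (hp : IsCond κ F p) (hpδ : IsGreatest p.1 δ)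
    (hz : IsCond κ F z) (hδz : δ ∈ z.1) : IsCond κ F (replaceStem p.1 δ z) := by
  have hg := isGreatest_replaceStem hpδ hz.isGreatest (hz.isGreatest.2 hδz)
  refine ⟨⟨_, hg.1⟩, ?_, ?_, ?_, hz.2.2.2.2⟩
  · rintro x (hx | hx)
    · exact hp.2.1 hx
    · exact hz.2.1 hx.1
  · rw [hg.csSup_eq]
    exact hz.2.2.1
  · intro s hs hne
    by_cases h : ∃ x ∈ s, δ < x
    · obtain ⟨x, hxs, hx⟩ := h
      have hb : BddAbove s := ⟨_, fun y hy => hg.2 (hs hy)⟩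
      have hsup : sSup s = sSup (s ∩ Ioi δ) := by
        apply le_antisymm
        · refine csSup_le hne fun y hy => ?_
          have hb' : BddAbove (s ∩ Ioi δ) := hb.mono inter_subset_left
          rcases lt_or_ge δ y with h | h
          · exact le_csSup hb' ⟨hy, h⟩
          · exact (h.trans hx.le).trans (le_csSup hb' ⟨hxs, hx⟩)
        · exact csSup_le_csSup hb ⟨x, hxs, hx⟩ inter_subset_left
      refine Or.inr ⟨?_, hx.trans_le (le_csSup hb hxs)⟩
      rw [hsup]
      refine hz.2.2.2.1 _ ?_ ⟨x, hxs, hx⟩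
      rintro y ⟨hys, hy⟩
      rcases hs hys with h | h
      · exact absurd (hpδ.2 h) (not_le.2 hy)
      · exact h.1
    · push Not at h
      refine Or.inl (hp.2.2.2.1 s (fun y hy => ?_) hne)
      rcases hs hy with h' | h'
      · exact h'
      · exact absurd (h y hy) (not_le.2 h'.2)

lemma mem_iff_of_condExt {δ : Ordinal.{u}} {p z : Set Ordinal.{u} × Set Ordinal.{u}}
    (hpδ : IsGreatest p.1 δ) (h : CondExt p z) {x : Ordinal.{u}} (hx : x ≤ δ) :
    x ∈ z.1 ↔ x ∈ p.1 := by
  have h1 := Set.ext_iff.1 h.1 x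
  rw [hpδ.csSup_eq] at h1
  simpa [hx] using h1

lemma mem_replaceStem_of_le {D : Set Ordinal.{u}} {δ x : Ordinal.{u}}
    (z : Set Ordinal.{u} × Set Ordinal.{u}) (hx : x ≤ δ) :
    x ∈ (replaceStem D δ z).1 ↔ x ∈ D := by
  simp [replaceStem, not_lt.2 hx]

lemma mem_replaceStem_of_lt {D : Set Ordinal.{u}} {δ x : Ordinal.{u}} (hD : IsGreatest D δ)
    (z : Set Ordinal.{u} × Set Ordinal.{u}) (hx : δ < x) :
    x ∈ (replaceStem D δ z).1 ↔ x ∈ z.1 := by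
  have : x ∉ D := fun h => (hD.2 h).not_gt hx
  simp [replaceStem, hx, this]

lemma condExt_replaceStem {δ : Ordinal.{u}} {p q z : Set Ordinal.{u} × Set Ordinal.{u}}
    (hp : IsGreatest p.1 δ) (hq : IsGreatest q.1 δ) (hpq : p.2 = q.2) (h : CondExt p z) :
    CondExt q (replaceStem q.1 δ z) := by
  refine ⟨?_, hpq ▸ h.2.1, ?_⟩
  · ext x
    rw [hq.csSup_eq, mem_inter_iff, mem_Iic]
    constructor
    · rintro ⟨h1, h2⟩
      exact (mem_replaceStem_of_le z h2).1 h1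
    · exact fun hx => ⟨Or.inl hx, hq.2 hx⟩
  · rintro x ⟨hx | hx, hxq⟩
    · exact absurd hx hxq
    · exact hpq ▸ h.2.2 ⟨hx.1, fun hxp => (hp.2 hxp).not_gt hx.2⟩

lemma replaceStem_replaceStem {δ : Ordinal.{u}} {p z : Set Ordinal.{u} × Set Ordinal.{u}}
    {D : Set Ordinal.{u}} (hp : IsGreatest p.1 δ) (hD : IsGreatest D δ) (h : CondExt p z) :
    replaceStem p.1 δ (replaceStem D δ z) = z := by
  refine Prod.ext (Set.ext fun x => ?_) rfl
  rcases le_or_gt x δ with hx | hx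
  · rw [mem_replaceStem_of_le _ hx, mem_iff_of_condExt hp h hx]
  · rw [mem_replaceStem_of_lt hp _ hx, mem_replaceStem_of_lt hD _ hx]

lemma CondExt.replaceStem {δ m : Ordinal.{u}} {D : Set Ordinal.{u}}
    {a b : Set Ordinal.{u} × Set Ordinal.{u}} (hD : IsGreatest D δ) (ha : IsGreatest a.1 m)
    (hm : δ ≤ m) (hab : CondExt a b) :
    CondExt (replaceStem D δ a) (replaceStem D δ b) := by
  refine ⟨?_, hab.2.1, ?_⟩
  · ext x
    rw [(isGreatest_replaceStem hD ha hm).csSup_eq, mem_inter_iff, mem_Iic]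
    rcases le_or_gt x δ with hx | hx
    · rw [mem_replaceStem_of_le _ hx, mem_replaceStem_of_le _ hx]
      exact and_iff_left (hx.trans hm)
    · rw [mem_replaceStem_of_lt hD _ hx, mem_replaceStem_of_lt hD _ hx]
      have h1 := Set.ext_iff.1 hab.1 x
      rwa [ha.csSup_eq] at h1
  · rintro x ⟨hxb, hxa⟩
    rcases le_or_gt x δ with hx | hx
    · rw [mem_replaceStem_of_le _ hx] at hxa hxb
      exact absurd hxb hxa
    · rw [mem_replaceStem_of_lt hD _ hx] at hxa hxb
      exact hab.2.2 ⟨hxb, hxa⟩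

lemma IsCond.exists_condExt {κ δ : Ordinal.{u}} {F : Set (Set Ordinal.{u})} {A : Set Ordinal.{u}}
    {p : Set Ordinal.{u} × Set Ordinal.{u}} (hp : IsCond κ F p) (hA : A ∈ F) (hAp : A ⊆ p.2)
    (hδA : δ ∈ A) (hδκ : δ < κ) (hδ : sSup p.1 < δ) :
    ∃ p', IsCond κ F p' ∧ CondExt p p' ∧ IsGreatest p'.1 δ ∧ p'.2 = A := by
  have hg : IsGreatest (insert δ p.1) δ :=
    ⟨mem_insert _ _, by
      rintro x (rfl | hx)
      · exact le_rfl
      · exact (hp.isGreatest.2 hx).trans hδ.le⟩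
  refine ⟨(insert δ p.1, A), ⟨⟨δ, hg.1⟩, insert_subset hδκ hp.2.1, ?_, ?_, hA⟩,
    ⟨?_, hAp, ?_⟩, hg, rfl⟩
  · exact hg.csSup_eq.trans_lt hδκ
  · intro s hs hne
    by_cases h : δ ∈ s
    · have : IsGreatest s δ := ⟨h, fun x hx => hg.2 (hs hx)⟩
      rw [this.csSup_eq]
      exact mem_insert _ _
    · exact Or.inr (hp.2.2.2.1 s ((subset_insert_iff_of_notMem h).1 hs) hne)
  · ext x
    constructor
    · rintro ⟨rfl | hx, h⟩
      · exact absurd h (not_le.2 hδ)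
      · exact hx
    · exact fun hx => ⟨Or.inr hx, hp.isGreatest.2 hx⟩
  · rintro x ⟨rfl | hx, h⟩
    · exact hAp hδA
    · exact absurd hx h

/-- If `κ` is a regular uncountable cardinal and `F` is a proper filter on `κ` all of whose
members are unbounded in `κ`, then the club-shooting poset `C_F` is cone homogeneous. -/
theorem clubShooting_coneHomogeneous
    (κ : Ordinal) (hcard : κ.card.ord = κ) (hreg : κ.card.IsRegular)
    (hunc : Cardinal.aleph0 < κ.card)
    (F : Set (Set Ordinal))
    (hFsub : ∀ A ∈ F, A ⊆ Set.Iio κ)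
    (hFuniv : Set.Iio κ ∈ F)
    (hFup : ∀ A ∈ F, ∀ B, A ⊆ B → B ⊆ Set.Iio κ → B ∈ F)
    (hFint : ∀ A ∈ F, ∀ B ∈ F, A ∩ B ∈ F)
    (hFproper : (∅ : Set Ordinal) ∉ F)
    (hFunbdd : ∀ A ∈ F, ∀ β < κ, ∃ x ∈ A, β < x) :
    ConeHomogeneous κ F := by
  intro p q hp hq
  have hAB := hFint _ hp.2.2.2.2 _ hq.2.2.2.2
  obtain ⟨δ, hδ, hlt⟩ := hFunbdd _ hAB _ (max_lt hp.2.2.1 hq.2.2.1)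
  have hδκ := hFsub _ hAB hδ
  obtain ⟨p', hp', hpp', hpδ, hpA⟩ := hp.exists_condExt hAB Set.inter_subset_left hδ hδκ
    ((le_max_left _ _).trans_lt hlt)
  obtain ⟨q', hq', hqq', hqδ, hqA⟩ := hq.exists_condExt hAB Set.inter_subset_right hδ hδκ
    ((le_max_right _ _).trans_lt hlt)
  have hpq : p'.2 = q'.2 := hpA.trans hqA.symm
  have hmp : ∀ z, CondExt p' z → δ ∈ z.1 := fun z hz =>
    (mem_iff_of_condExt hpδ hz le_rfl).2 hpδ.1
  have hmq : ∀ z, CondExt q' z → δ ∈ z.1 := fun z hz =>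
    (mem_iff_of_condExt hqδ hz le_rfl).2 hqδ.1
  refine ⟨p', q', hp', hq', hpp', hqq',
    { toFun := fun z => ⟨replaceStem q'.1 δ z.1,
        isCond_replaceStem hq' hqδ z.2.1 (hmp _ z.2.2), condExt_replaceStem hpδ hqδ hpq z.2.2⟩
      invFun := fun z => ⟨replaceStem p'.1 δ z.1,
        isCond_replaceStem hp' hpδ z.2.1 (hmq _ z.2.2),
        condExt_replaceStem hqδ hpδ hpq.symm z.2.2⟩
      left_inv := fun z => Subtype.ext (replaceStem_replaceStem hpδ hqδ z.2.2)
      right_inv := fun z => Subtype.ext (replaceStem_replaceStem hqδ hpδ z.2.2) },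
    fun a b => ⟨fun h => ?_, fun h => ?_⟩⟩
  · exact h.replaceStem hqδ a.2.1.isGreatest (a.2.1.isGreatest.2 (hmp _ a.2.2))
  · have hg := isGreatest_replaceStem hqδ a.2.1.isGreatest (a.2.1.isGreatest.2 (hmp _ a.2.2))
    have h' := CondExt.replaceStem hpδ hg (a.2.1.isGreatest.2 (hmp _ a.2.2)) h
    rwa [Equiv.coe_fn_mk, replaceStem_replaceStem hpδ hqδ a.2.2,
      replaceStem_replaceStem hpδ hqδ b.2.2] at h'
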